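/- For all integers N and d with N ≥ d + 2 > 4 (i.e., d ≥ 3 and N ≥ d + 2), any two non-orthodecomposable frames F, G ∈ 𝓕_{N,d}^ℝ are joined by a continuous path inside 𝓕_{N,d}^ℝ all of whose points are non-orthodecomposable; that is, the NOD frames in 𝓕_{N,d}^ℝ form a path-connected set. -/

import Mathlib

noncomputable section

/-- The set of finite unit norm tight frames (FUNTFs) of `N` vectors in `𝕜^d`,
viewed as `d × N` matrices `F` with unit-norm columns and `F * Fᴴ = (N/d) • 1`. -/
def FUNTF (𝕜 : Type*) [RCLike 𝕜] (N d : ℕ) : Set (Matrix (Fin d) (Fin N) 𝕜) :=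
  {F | F * F.conjTranspose = ((N : 𝕜) / (d : 𝕜)) • 1 ∧
       ∀ n, (F.conjTranspose * F) n n = 1}

/-- The `j`-th column of a matrix, as a vector in Euclidean space. -/
def col {𝕜 : Type*} [RCLike 𝕜] {m n : ℕ} (F : Matrix (Fin m) (Fin n) 𝕜) (j : Fin n) :
    EuclideanSpace 𝕜 (Fin m) :=
  (WithLp.equiv 2 (Fin m → 𝕜)).symm fun i => F i j

/-- A family of vectors is orthodecomposable (OD) if the index set admits a partition into
two nonempty sets `S`, `T` such that the span of the vectors indexed by `S` is the orthogonal
complement of the span of the vectors indexed by `T`. -/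
def Orthodecomposable (𝕜 : Type*) [RCLike 𝕜] {E : Type*} [NormedAddCommGroup E]
    [InnerProductSpace 𝕜 E] {ι : Type*} (f : ι → E) : Prop :=
  ∃ S T : Set ι, S.Nonempty ∧ T.Nonempty ∧ Disjoint S T ∧ S ∪ T = Set.univ ∧
    Submodule.span 𝕜 (f '' S) = (Submodule.span 𝕜 (f '' T))ᗮ

open scoped Matrix.Norms.L2Operator in
lemma nodx_sqrt_path {d : ℕ} (M : unitInterval → Matrix (Fin d) (Fin d) ℝ) (hM : Continuous M)
    (hp : ∀ s, (M s).PosDef) :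
    ∃ B : unitInterval → Matrix (Fin d) (Fin d) ℝ, Continuous B ∧ (∀ s, (B s).transpose = B s) ∧
      (∀ s, B s * B s = (M s)⁻¹) ∧
      ∀ s (c : ℝ), 0 < c → M s = c • 1 → B s = (Real.sqrt c⁻¹) • 1 := by
  have hc : Continuous fun s => (M s)⁻¹ := by
    refine continuous_iff_continuousAt.2 fun s => ?_
    have h1 : (M s).det ≠ 0 := (hp s).det_pos.ne'
    have : (fun s => (M s)⁻¹) = fun s => (M s).det⁻¹ • (M s).adjugate := by
      ext1 s; rw [Matrix.inv_def, Ring.inverse_eq_inv']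
    rw [this]
    exact (hM.matrix_det.continuousAt.inv₀ h1).smul hM.matrix_adjugate.continuousAt
  have hpi : ∀ s, ((M s)⁻¹).PosDef := fun s => (hp s).inv
  have hsa : ∀ s, IsSelfAdjoint ((M s)⁻¹) := fun s => (hpi s).isHermitian
  obtain ⟨C, hC⟩ := (isCompact_range hc).isBounded.exists_norm_le
  have hsp : ∀ s, spectrum ℝ ((M s)⁻¹) ⊆ Set.Icc 0 (C * ‖(1 : Matrix (Fin d) (Fin d) ℝ)‖) := by
    intro s x hx
    constructor
    · exact (Matrix.posSemidef_iff_isHermitian_and_spectrum_nonneg.1 (hpi s).posSemidef).2 hx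
    · have := spectrum.norm_le_norm_mul_of_mem hx
      refine (le_abs_self x).trans (this.trans ?_)
      gcongr
      exact hC _ ⟨s, rfl⟩
  refine ⟨fun s => cfc Real.sqrt ((M s)⁻¹), ?_, ?_, ?_, ?_⟩
  · exact Continuous.cfc' (isCompact_Icc) Real.sqrt hc hsp Real.continuous_sqrt.continuousOn hsa
  · intro s
    have : IsSelfAdjoint (cfc Real.sqrt ((M s)⁻¹)) := cfc_predicate _ _
    exact this
  · intro s
    rw [← cfc_mul Real.sqrt Real.sqrt ((M s)⁻¹)]
    have h2 : Set.EqOn (fun x => Real.sqrt x * Real.sqrt x) id (spectrum ℝ ((M s)⁻¹)) := by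
      intro x hx
      exact Real.mul_self_sqrt (hsp s hx).1
    rw [cfc_congr h2]
    exact cfc_id ℝ _ (hsa s)
  · intro s c hc0 h
    have : (M s)⁻¹ = algebraMap ℝ _ c⁻¹ := by
      rw [h, Algebra.algebraMap_eq_smul_one]
      apply Matrix.inv_eq_right_inv
      simp [smul_smul, hc0.ne']
    simp only [this]
    rw [cfc_algebraMap, Algebra.algebraMap_eq_smul_one]

open Module

/-- Stability of a configuration of vectors. -/
def NodStable {N : ℕ} {E : Type*} [AddCommGroup E] [Module ℝ E] (x : Fin N → E) : Prop :=
  ∀ V : Submodule ℝ E, V ≠ ⊤ → ∀ S : Finset (Fin N), S.Nonempty → (∀ n ∈ S, x n ∈ V) →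
    finrank ℝ E * S.card < N * finrank ℝ V

lemma NodStable.map {N : ℕ} {E E' : Type*} [AddCommGroup E] [Module ℝ E] [AddCommGroup E']
    [Module ℝ E'] {x : Fin N → E} (h : NodStable x) (e : E ≃ₗ[ℝ] E') (c : Fin N → ℝ)
    (hc : ∀ n, c n ≠ 0) : NodStable (fun n => c n • e (x n)) := by
  intro V hV S hS hx
  have h1 := h (V.comap e.toLinearMap) ?_ S hS ?_
  · have h2 : finrank ℝ (V.comap e.toLinearMap) = finrank ℝ V := by
      rw [Submodule.comap_equiv_eq_map_symm]
      exact LinearEquiv.finrank_map_eq e.symm V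
    rwa [h2, e.finrank_eq] at h1
  · intro h2
    apply hV
    rw [eq_top_iff]
    intro y _
    have : e.symm y ∈ V.comap e.toLinearMap := by rw [h2]; trivial
    simpa using this
  · intro n hn
    have := V.smul_mem (c n)⁻¹ (hx n hn)
    rw [smul_smul, inv_mul_cancel₀ (hc n), one_smul] at this
    simpa using this

lemma nodx_chart {N d : ℕ} (x : Fin N → Fin d → ℝ) (h : ¬ NodStable x) :
    ∃ (R : Finset (Fin d)) (S : Finset (Fin N)), S.Nonempty ∧ R.card < d ∧
      N * R.card ≤ d * S.card ∧
      ∃ M : {i // i ∉ R} × {i // i ∈ R} → ℝ, ∀ n ∈ S, ∀ i (hi : i ∉ R),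
        x n i = ∑ r : {i // i ∈ R}, M (⟨i, hi⟩, r) * x n r := by
  classical
  unfold NodStable at h
  push Not at h
  obtain ⟨V, hV, S, hS, hx, hcard⟩ := h
  have hk : finrank ℝ V < d := by
    have := Submodule.finrank_lt hV
    simpa using this
  let f : Fin d → Dual ℝ V := fun i => (LinearMap.proj i).comp V.subtype
  obtain ⟨κ, a, ha, hspan, hli⟩ := exists_linearIndependent' ℝ f
  have : Finite κ := Finite.of_injective a ha
  have := Fintype.ofFinite κ
  have hcκ : Fintype.card κ ≤ finrank ℝ V := by
    have := hli.fintype_card_le_finrank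
    rwa [Subspace.dual_finrank_eq] at this
  let R : Finset (Fin d) := Finset.univ.image a
  have hR : R.card ≤ finrank ℝ V := Finset.card_image_le.trans hcκ
  have hmem : ∀ i, ∃ m : {i // i ∈ R} → ℝ, f i = ∑ r : {i // i ∈ R}, m r • f r := by
    intro i
    have h1 : f i ∈ Submodule.span ℝ (Set.range (f ∘ a)) := by
      rw [hspan]; exact Submodule.subset_span ⟨i, rfl⟩
    have h2 : Set.range (f ∘ a) = Set.range (fun r : {i // i ∈ R} => f r) := by
      ext g
      simp [R]
    rw [h2, Submodule.mem_span_range_iff_exists_fun] at h1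
    obtain ⟨m, hm⟩ := h1
    exact ⟨m, hm.symm⟩
  choose m hm using hmem
  refine ⟨R, S, hS, by omega, ?_, fun p => m p.1 p.2, ?_⟩
  · rw [finrank_fin_fun] at hcard
    exact (Nat.mul_le_mul_left N hR).trans hcard
  · intro n hn i hi
    have := congrArg (fun g : Dual ℝ V => g ⟨x n, hx n hn⟩) (hm i)
    simpa [f] using this

/-- Parameters for the bad set. -/
abbrev NodPar {N d : ℕ} (R : Finset (Fin d)) (S : Finset (Fin N)) : Type :=
  (({i // i ∉ R} × {i // i ∈ R} → ℝ) × ({q : Fin N × Fin d // ¬ (q.1 ∈ S ∧ q.2 ∉ R)} → ℝ)) × ℝ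

/-- The parametrization of the bad set. -/
def nodB {N d : ℕ} (R : Finset (Fin d)) (S : Finset (Fin N)) (p : NodPar R S) (n : Fin N)
    (i : Fin d) : ℝ :=
  if h : n ∈ S ∧ i ∉ R then
    ∑ r : {i // i ∈ R}, p.1.1 (⟨i, h.2⟩, r) * p.1.2 ⟨(n, r), fun h => h.2 r.2⟩
  else p.1.2 ⟨(n, i), h⟩

/-- The cone map. -/
def nodMap {N d : ℕ} (R : Finset (Fin d)) (S : Finset (Fin N)) (a : Fin N → Fin d → ℝ)
    (p : NodPar R S) : Fin N → Fin d → ℝ :=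
  fun n i => a n i + p.2 * (nodB R S p n i - a n i)

lemma nodMap_contDiff {N d : ℕ} (R : Finset (Fin d)) (S : Finset (Fin N))
    (a : Fin N → Fin d → ℝ) : ContDiff ℝ 1 (nodMap R S a) := by
  refine contDiff_pi.2 fun n => contDiff_pi.2 fun i => ?_
  have h1 : ContDiff ℝ 1 (fun p : NodPar R S => nodB R S p n i) := by
    unfold nodB
    split_ifs with h
    · fun_prop
    · fun_prop
  unfold nodMap
  fun_prop

lemma nodx_arith {N d r m : ℕ} (hd : 3 ≤ d) (hN : d + 2 ≤ N) (hr : r < d) (hm : 1 ≤ m)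
    (h : N * r ≤ d * m) : (d - r) * r + 2 ≤ m * (d - r) := by
  obtain ⟨e, rfl⟩ : ∃ e, d = r + e := ⟨d - r, by omega⟩
  have he : 1 ≤ e := by omega
  rw [Nat.add_sub_cancel_left]
  rcases Nat.eq_zero_or_pos r with rfl | hr0
  · simp at *
    nlinarith
  · have h1 : (r + e + 2) * r ≤ (r + e) * m := (Nat.mul_le_mul_right r hN).trans h
    have h2 : r < m := by
      by_contra hlt
      push Not at hlt
      nlinarith
    obtain ⟨q, rfl⟩ : ∃ q, m = r + q := ⟨m - r, by omega⟩
    have hq : 1 ≤ q := by omega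
    have : 2 ≤ q * e := by
      rcases Nat.lt_or_ge e 2 with h3 | h3
      · have : e = 1 := by omega
        subst this
        rcases Nat.lt_or_ge q 2 with h4 | h4
        · have : q = 1 := by omega
          subst this
          nlinarith
        · omega
      · nlinarith
    nlinarith

lemma nodPar_finrank {N d : ℕ} (hd : 3 ≤ d) (hN : d + 2 ≤ N) (R : Finset (Fin d))
    (S : Finset (Fin N)) (hS : S.Nonempty) (hR : R.card < d) (h : N * R.card ≤ d * S.card) :
    finrank ℝ (NodPar R S) + 1 ≤ N * d := by
  classical
  have h1 := nodx_arith hd hN hR hS.card_pos h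
  have h2 : Fintype.card {q : Fin N × Fin d // ¬ (q.1 ∈ S ∧ q.2 ∉ R)} =
      N * d - S.card * (d - R.card) := by
    rw [Fintype.card_subtype_compl, Fintype.card_prod, Fintype.card_fin, Fintype.card_fin]
    congr 1
    rw [Fintype.card_subtype]
    have : (Finset.univ.filter fun q : Fin N × Fin d => q.1 ∈ S ∧ q.2 ∉ R) = S ×ˢ Rᶜ := by
      ext q; simp
    rw [this, Finset.card_product, Finset.card_compl, Fintype.card_fin]
  have h3 : Fintype.card {i // i ∉ R} = d - R.card := by
    rw [Fintype.card_subtype_compl]; simp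
  have h4 : S.card * (d - R.card) ≤ N * d :=
    Nat.mul_le_mul (by simpa using S.card_le_univ) (Nat.sub_le _ _)
  have h5 : finrank ℝ (NodPar R S) = (d - R.card) * R.card +
      (N * d - S.card * (d - R.card)) + 1 := by
    simp only [NodPar, finrank_prod, finrank_fintype_fun_eq_card, Fintype.card_prod, h2, h3,
      finrank_self, Fintype.card_coe]
  omega

lemma nodx_dim {N d : ℕ} (hd : 3 ≤ d) (hN : d + 2 ≤ N) (x y : Fin N → Fin d → ℝ)
    (hx : NodStable x) (hy : NodStable y) : JoinedIn {x : Fin N → Fin d → ℝ | NodStable x} x y := by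
  classical
  let ι := {q : Finset (Fin d) × Finset (Fin N) // q.2.Nonempty ∧ q.1.card < d ∧
    N * q.1.card ≤ d * q.2.card}
  let Bad : Set (Fin N → Fin d → ℝ) :=
    ⋃ q : ι × Bool, Set.range (nodMap q.1.1.1 q.1.1.2 (if q.2 then x else y))
  have hdim : dimH Bad < finrank ℝ (Fin N → Fin d → ℝ) := by
    have h1 : finrank ℝ (Fin N → Fin d → ℝ) = N * d := by
      simp [Module.finrank_pi_fintype]
    rw [h1]
    have h2 : dimH Bad ≤ ((N * d - 1 : ℕ) : ENNReal) := by
      rw [dimH_iUnion]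
      refine iSup_le fun q => ((nodMap_contDiff _ _ _).dimH_range_le).trans ?_
      have := nodPar_finrank hd hN q.1.1.1 q.1.1.2 q.1.2.1 q.1.2.2.1 q.1.2.2.2
      exact_mod_cast (by omega : finrank ℝ (NodPar q.1.1.1 q.1.1.2) ≤ N * d - 1)
    refine h2.trans_lt ?_
    have : 0 < N * d := Nat.mul_pos (by omega) (by omega)
    exact_mod_cast (by omega : N * d - 1 < N * d)
  obtain ⟨z, hz⟩ := (dense_compl_of_dimH_lt_finrank hdim).nonempty
  have key : ∀ b : Bool, NodStable (if b then x else y) →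
      JoinedIn {x : Fin N → Fin d → ℝ | NodStable x} (if b then x else y) z := by
    intro b hb
    apply JoinedIn.of_segment_subset
    rw [segment_eq_image']
    rintro _ ⟨t, ⟨ht0, ht1⟩, rfl⟩
    set a := if b then x else y with ha
    rcases ht0.eq_or_lt with rfl | ht
    · simpa using hb
    · by_contra hbad
      obtain ⟨R, S, hS, hR, hc, M, hM⟩ := nodx_chart _ hbad
      apply hz
      refine Set.mem_iUnion.2 ⟨(⟨(R, S), hS, hR, hc⟩, b), ?_⟩
      set w : Fin N → Fin d → ℝ := a + t • (z - a) with hw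
      refine ⟨((M, fun q => w q.1.1 q.1.2), t⁻¹), ?_⟩
      have hB : ∀ n i, nodB R S ((M, fun q => w q.1.1 q.1.2), t⁻¹) n i = w n i := by
        intro n i
        unfold nodB
        split_ifs with h
        · exact (hM n h.1 i h.2).symm
        · rfl
      ext n i
      simp only [nodMap, hB]
      rw [← ha, hw]
      simp only [Pi.add_apply, Pi.smul_apply, Pi.sub_apply, smul_eq_mul]
      field_simp
      ring
  exact (key true hx).trans (key false hy).symm
/-- Sum of exponentials. -/
def nodG {W Φ : Type*} [Fintype Φ] (l : Φ → W → ℝ) (c : Φ → ℝ) (w : W) : ℝ :=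
  ∑ φ, c φ * Real.exp (l φ w)

lemma nodG_exists_min {W Φ : Type*} [Fintype Φ] [NormedAddCommGroup W] [NormedSpace ℝ W]
    [FiniteDimensional ℝ W] (l : Φ → W →L[ℝ] ℝ) (c : Φ → ℝ) (hc : ∀ φ, 0 ≤ c φ)
    (h : ∀ v, v ≠ 0 → ∃ φ, 0 < c φ ∧ 0 < l φ v) :
    ∃ w, ∀ w', nodG (fun φ => l φ) c w ≤ nodG (fun φ => l φ) c w' := by
  have : ProperSpace W := FiniteDimensional.proper_real W
  let H : W → ℝ := fun v => ∑ φ, c φ * max (l φ v) 0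
  have hHc : Continuous H := by fun_prop
  have hgc : Continuous (nodG (fun φ => l φ) c) := by unfold nodG; fun_prop
  have hpos : ∀ v, v ≠ 0 → 0 < H v := by
    intro v hv
    obtain ⟨φ, h1, h2⟩ := h v hv
    refine Finset.sum_pos' (fun φ _ => mul_nonneg (hc φ) (le_max_right _ _)) ⟨φ, Finset.mem_univ _, ?_⟩
    exact mul_pos h1 (lt_max_of_lt_left h2)
  have hGH : ∀ w, H w ≤ nodG (fun φ => l φ) c w := by
    intro w
    refine Finset.sum_le_sum fun φ _ => mul_le_mul_of_nonneg_left ?_ (hc φ)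
    refine max_le ?_ (Real.exp_pos _).le
    linarith [Real.add_one_le_exp (l φ w)]
  have hhom : ∀ (r : ℝ) v, 0 ≤ r → H (r • v) = r * H v := by
    intro r v hr
    simp only [H, map_smul, smul_eq_mul, Finset.mul_sum]
    refine Finset.sum_congr rfl fun φ _ => ?_
    rw [show max (r * l φ v) 0 = r * max (l φ v) 0 by
      rw [mul_max_of_nonneg _ _ hr, mul_zero]]
    ring
  rcases subsingleton_or_nontrivial W with hW | hW
  · exact ⟨0, fun w' => by rw [Subsingleton.elim w' 0]⟩
  obtain ⟨v0, hv0, hmin⟩ := (isCompact_sphere (0 : W) 1).exists_isMinOn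
    (NormedSpace.sphere_nonempty.2 zero_le_one) hHc.continuousOn
  have hδ : 0 < H v0 := hpos v0 (by rintro rfl; simp at hv0)
  have hlow : ∀ w, H v0 * ‖w‖ ≤ nodG (fun φ => l φ) c w := by
    intro w
    refine le_trans ?_ (hGH w)
    rcases eq_or_ne w 0 with rfl | hw
    · simp [H]
    have hn : 0 < ‖w‖ := norm_pos_iff.2 hw
    have h1 : H v0 ≤ H (‖w‖⁻¹ • w) := hmin (by simp [norm_smul, hn.ne'])
    rw [hhom _ _ (by positivity)] at h1
    calc H v0 * ‖w‖ ≤ (‖w‖⁻¹ * H w) * ‖w‖ := by gcongr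
      _ = H w := by field_simp
  refine hgc.exists_forall_le ?_
  refine Filter.tendsto_atTop_mono hlow ?_
  exact (tendsto_norm_cocompact_atTop).const_mul_atTop hδ

lemma nodG_convex {W Φ : Type*} [Fintype Φ] [AddCommGroup W] [Module ℝ W]
    (l : Φ → W →ₗ[ℝ] ℝ) (c : Φ → ℝ) (hc : ∀ φ, 0 ≤ c φ) :
    ConvexOn ℝ Set.univ (nodG (fun φ => l φ) c) := by
  refine ⟨convex_univ, fun x _ y _ a b ha hb hab => ?_⟩
  simp only [nodG, smul_eq_mul, Finset.mul_sum]
  rw [← Finset.sum_add_distrib]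
  refine Finset.sum_le_sum fun φ _ => ?_
  have := convexOn_exp.2 (Set.mem_univ (l φ x)) (Set.mem_univ (l φ y)) ha hb hab
  simp only [smul_eq_mul] at this
  simp only [map_add, map_smul, smul_eq_mul]
  nlinarith [mul_le_mul_of_nonneg_left this (hc φ)]

lemma nodG_unique {W Φ : Type*} [Fintype Φ] [AddCommGroup W] [Module ℝ W]
    (l : Φ → W →ₗ[ℝ] ℝ) (c : Φ → ℝ) (hc : ∀ φ, 0 ≤ c φ)
    (h : ∀ v, v ≠ 0 → ∃ φ, 0 < c φ ∧ 0 < l φ v) (x y : W)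
    (hx : ∀ w, nodG (fun φ => l φ) c x ≤ nodG (fun φ => l φ) c w)
    (hy : ∀ w, nodG (fun φ => l φ) c y ≤ nodG (fun φ => l φ) c w) : x = y := by
  by_contra hne
  obtain ⟨φ0, h1, h2⟩ := h (x - y) (sub_ne_zero.2 hne)
  have h3 : l φ0 x ≠ l φ0 y := by
    intro h4; rw [map_sub, h4, sub_self] at h2; exact lt_irrefl _ h2
  have hlt : nodG (fun φ => l φ) c ((1/2 : ℝ) • x + (1/2 : ℝ) • y) <
      (1/2 : ℝ) * nodG (fun φ => l φ) c x + (1/2) * nodG (fun φ => l φ) c y := by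
    simp only [nodG, Finset.mul_sum]
    rw [← Finset.sum_add_distrib]
    refine Finset.sum_lt_sum (fun φ _ => ?_) ⟨φ0, Finset.mem_univ _, ?_⟩
    · have := convexOn_exp.2 (Set.mem_univ (l φ x)) (Set.mem_univ (l φ y))
        (by norm_num : (0:ℝ) ≤ 1/2) (by norm_num : (0:ℝ) ≤ 1/2) (by norm_num)
      simp only [smul_eq_mul] at this
      simp only [map_add, map_smul, smul_eq_mul]
      nlinarith [mul_le_mul_of_nonneg_left this (hc φ)]
    · have := strictConvexOn_exp.2 (Set.mem_univ (l φ0 x)) (Set.mem_univ (l φ0 y)) h3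
        (by norm_num : (0:ℝ) < 1/2) (by norm_num : (0:ℝ) < 1/2) (by norm_num)
      simp only [smul_eq_mul] at this
      simp only [map_add, map_smul, smul_eq_mul]
      nlinarith [mul_lt_mul_of_pos_left this h1]
  have := hx ((1/2 : ℝ) • x + (1/2 : ℝ) • y)
  have h5 := hy x
  linarith

lemma nodG_continuous_min {I W Φ : Type*} [TopologicalSpace I] [Fintype Φ] [NormedAddCommGroup W]
    [NormedSpace ℝ W] [FiniteDimensional ℝ W] (l : Φ → W →L[ℝ] ℝ) (c : I → Φ → ℝ)
    (hcc : Continuous c) (hc : ∀ s φ, 0 ≤ c s φ)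
    (h : ∀ s v, v ≠ 0 → ∃ φ, 0 < c s φ ∧ 0 < l φ v) :
    ∃ τ : I → W, Continuous τ ∧
      ∀ s w, nodG (fun φ => l φ) (c s) (τ s) ≤ nodG (fun φ => l φ) (c s) w := by
  have : ProperSpace W := FiniteDimensional.proper_real W
  choose τ hτ using fun s => nodG_exists_min l (c s) (hc s) (h s)
  refine ⟨τ, ?_, hτ⟩
  have hun : ∀ s w, (∀ w', nodG (fun φ => l φ) (c s) w ≤ nodG (fun φ => l φ) (c s) w') →
      w = τ s := fun s w hw =>
    nodG_unique (fun φ => (l φ : W →ₗ[ℝ] ℝ)) (c s) (hc s) (h s) w (τ s) hw (hτ s)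
  have hjc : Continuous (fun p : I × W => nodG (fun φ => l φ) (c p.1) p.2) := by
    unfold nodG; fun_prop
  rw [continuous_iff_continuousAt]
  intro s0
  rw [Metric.continuousAt_iff']
  intro ε hε
  have hsph : ∀ᶠ s in nhds s0, ∀ w ∈ Metric.sphere (τ s0) (ε / 2),
      nodG (fun φ => l φ) (c s) (τ s0) < nodG (fun φ => l φ) (c s) w := by
    refine (isCompact_sphere (τ s0) (ε / 2)).eventually_forall_of_forall_eventually ?_
    intro w hw
    have hlt : nodG (fun φ => l φ) (c s0) (τ s0) < nodG (fun φ => l φ) (c s0) w := by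
      refine lt_of_le_of_ne (hτ s0 w) fun heq => ?_
      have : w = τ s0 := hun s0 w fun w' => heq ▸ hτ s0 w'
      rw [this] at hw
      simp at hw
      linarith
    have hA : Continuous (fun p : I × W => nodG (fun φ => l φ) (c p.1) (τ s0)) :=
      hjc.comp (by fun_prop : Continuous fun p : I × W => (p.1, τ s0))
    exact (isOpen_lt hA hjc).mem_nhds (show ((s0, w) : I × W) ∈ {p : I × W | _ < _} from hlt)
  filter_upwards [hsph] with s hs
  by_contra hfar
  push Not at hfar
  -- the point of the segment at distance ε/2
  set D := dist (τ s) (τ s0) with hD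
  have hDpos : 0 < D := lt_of_lt_of_le hε hfar
  set r := (ε / 2) / D with hr
  have hr0 : 0 < r := by positivity
  have hr1 : r ≤ 1 := by rw [hr, div_le_one hDpos]; linarith
  set w := (1 - r) • τ s0 + r • τ s with hw
  have hws : w ∈ Metric.sphere (τ s0) (ε / 2) := by
    rw [mem_sphere_iff_norm]
    have : w - τ s0 = r • (τ s - τ s0) := by rw [hw]; module
    rw [this, norm_smul, Real.norm_of_nonneg hr0.le, ← dist_eq_norm, ← hD, hr]
    field_simp
  have h1 := hs w hws
  have h2 := (nodG_convex (fun φ => (l φ : W →ₗ[ℝ] ℝ)) (c s) (hc s)).2 (Set.mem_univ (τ s0))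
    (Set.mem_univ (τ s)) (sub_nonneg.2 hr1) hr0.le (by ring)
  have h3 := hτ s (τ s0)
  simp only [smul_eq_mul, ContinuousLinearMap.coe_coe] at h2
  rw [← hw] at h2
  nlinarith

/-- Weighted frame operator. -/
def nodM {N d : ℕ} (x : Fin N → Fin d → ℝ) (w : Fin N → ℝ) : Matrix (Fin d) (Fin d) ℝ :=
  ∑ n, w n • Matrix.vecMulVec (x n) (x n)

/-- Submatrix of chosen vectors (as rows). -/
def nodX {N d : ℕ} (x : Fin N → Fin d → ℝ) (φ : Fin d → Fin N) : Matrix (Fin d) (Fin d) ℝ :=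
  Matrix.of fun i => x (φ i)

lemma nodM_det {N d : ℕ} (x : Fin N → Fin d → ℝ) (w : Fin N → ℝ) :
    (d.factorial : ℝ) * (nodM x w).det =
      ∑ φ : Fin d → Fin N, (nodX x φ).det ^ 2 * ∏ i, w (φ i) := by
  classical
  have h1 : (nodM x w).det = ∑ φ : Fin d → Fin N,
      (∏ i, (w (φ i) * x (φ i) i)) * (nodX x φ).det := by
    have h2 : nodM x w = fun i => ∑ n, (w n * x n i) • x n := by
      ext i j
      simp [nodM, Matrix.sum_apply, Matrix.vecMulVec_apply, mul_assoc]
    have h3 := (Matrix.detRowAlternating (R := ℝ) (n := Fin d)).toMultilinearMap.map_sum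
      (fun i n => (w n * x n i) • x n)
    have h4 : (nodM x w).det = (Matrix.detRowAlternating (R := ℝ) (n := Fin d)).toMultilinearMap
      (fun i => ∑ n, (w n * x n i) • x n) := by rw [h2]; rfl
    rw [h4, h3]
    refine Finset.sum_congr rfl fun φ _ => ?_
    rw [MultilinearMap.map_smul_univ]
    rfl
  have h2 : ∀ σ : Equiv.Perm (Fin d), (nodM x w).det = ∑ φ : Fin d → Fin N,
      (∏ i, w (φ i)) * (nodX x φ).det * ((Equiv.Perm.sign σ : ℤ) * ∏ i, x (φ (σ i)) i) := by
    intro σ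
    rw [h1, ← (Equiv.arrowCongr σ (Equiv.refl (Fin N))).symm.sum_comp]
    refine Finset.sum_congr rfl fun φ _ => ?_
    have e1 : (Equiv.arrowCongr σ (Equiv.refl (Fin N))).symm φ = φ ∘ σ := by
      ext i; simp [Equiv.arrowCongr]
    rw [e1]
    have e2 : (nodX x (φ ∘ σ)).det = (Equiv.Perm.sign σ : ℤ) * (nodX x φ).det := by
      have := Matrix.det_permute σ (nodX x φ)
      exact this
    rw [e2, Finset.prod_mul_distrib]
    have e3 : ∏ i, w ((φ ∘ σ) i) = ∏ i, w (φ i) := Equiv.prod_comp σ (fun i => w (φ i))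
    rw [e3]
    simp only [Function.comp]
    ring
  have h3 : (d.factorial : ℝ) * (nodM x w).det = ∑ σ : Equiv.Perm (Fin d), (nodM x w).det := by
    simp [Fintype.card_perm]
  rw [h3, Finset.sum_congr rfl fun σ _ => h2 σ, Finset.sum_comm]
  refine Finset.sum_congr rfl fun φ _ => ?_
  rw [← Finset.mul_sum]
  have : ∑ σ : Equiv.Perm (Fin d), (((Equiv.Perm.sign σ : ℤ) : ℝ) * ∏ i, x (φ (σ i)) i) =
      (nodX x φ).det := by
    rw [Matrix.det_apply']
    rfl
  rw [this]
  ring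

lemma nodx_layer {N : ℕ} (v : Fin N → ℝ) (L R : ℝ) (hL : ∀ n, L ≤ v n) (hR : ∀ n, v n ≤ R) :
    IntervalIntegrable (fun t => ((Finset.univ.filter fun n => t ≤ v n).card : ℝ))
      MeasureTheory.volume L R ∧
    ∫ t in L..R, ((Finset.univ.filter fun n => t ≤ v n).card : ℝ) = ∑ n, (v n - L) := by
  have h1 : (fun t => ((Finset.univ.filter fun n => t ≤ v n).card : ℝ)) =
      fun t => ∑ n, Set.indicator {t | t ≤ v n} (fun _ => (1 : ℝ)) t := by
    ext t
    simp only [Set.indicator_apply, Set.mem_ofPred_eq, Finset.sum_boole]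
  have h2 : ∀ n, IntervalIntegrable (Set.indicator {t | t ≤ v n} (fun _ => (1 : ℝ)))
      MeasureTheory.volume L R := by
    intro n
    apply Antitone.intervalIntegrable
    intro a b hab
    simp only [Set.indicator_apply, Set.mem_ofPred_eq]
    split_ifs with h3 h4 <;> first | (exact absurd (hab.trans h3) h4) | norm_num
  rw [h1]
  constructor
  · have := IntervalIntegrable.sum Finset.univ (fun n _ => h2 n)
    have e : (∑ n, Set.indicator {t | t ≤ v n} (fun _ => (1 : ℝ))) =
        fun t => ∑ n, Set.indicator {t | t ≤ v n} (fun _ => (1 : ℝ)) t := by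
      ext t; simp only [Finset.sum_apply]
    rwa [e] at this
  · rw [intervalIntegral.integral_finsetSum (fun n _ => h2 n)]
    refine Finset.sum_congr rfl fun n _ => ?_
    rw [intervalIntegral.integral_indicator ⟨hL n, hR n⟩]
    simp

lemma nodx_exists_basis {N d : ℕ} (hN : 0 < N) (x : Fin N → Fin d → ℝ) (hx : NodStable x) :
    ∃ φ : Fin d → Fin N, (nodX x φ).det ≠ 0 := by
  classical
  have htop : Submodule.span ℝ (Set.range x) = ⊤ := by
    by_contra hne
    have h1 := hx _ hne Finset.univ (by have : Nonempty (Fin N) := ⟨⟨0, hN⟩⟩; exact Finset.univ_nonempty)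
      (fun n _ => Submodule.subset_span ⟨n, rfl⟩)
    have h2 := Submodule.finrank_le (Submodule.span ℝ (Set.range x))
    rw [Finset.card_univ, Fintype.card_fin] at h1
    nlinarith
  obtain ⟨κ, a, ha, hspan, hli⟩ := exists_linearIndependent' ℝ x
  have : Finite κ := Finite.of_injective a ha
  have := Fintype.ofFinite κ
  let b := Basis.mk hli (by rw [hspan, htop])
  have hcard : Fintype.card κ = d := by
    have := finrank_eq_card_basis b
    simpa using this.symm
  let e : Fin d ≃ κ := (Fintype.equivFinOfCardEq hcard).symm
  refine ⟨a ∘ e, ?_⟩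
  have h1 : LinearIndependent ℝ (nodX x (a ∘ e)).row := hli.comp e e.injective
  rw [Matrix.linearIndependent_rows_iff_isUnit, Matrix.isUnit_iff_isUnit_det] at h1
  exact h1.ne_zero

lemma nodx_greedy {N d : ℕ} (hN : 0 < N) (hd : 0 < d) (x : Fin N → Fin d → ℝ) (hx : NodStable x)
    (v : Fin N → ℝ) (hv : ∃ n m, v n ≠ v m) :
    ∃ φ : Fin d → Fin N, (nodX x φ).det ≠ 0 ∧ d * ∑ n, v n < N * ∑ i, v (φ i) := by
  classical
  obtain ⟨φ, hφ, hmax⟩ := Finset.exists_max_image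
    (Finset.univ.filter fun φ : Fin d → Fin N => (nodX x φ).det ≠ 0) (fun φ => ∑ i, v (φ i))
    (by obtain ⟨φ, h⟩ := nodx_exists_basis hN x hx; exact ⟨φ, by simpa using h⟩)
  replace hφ : (nodX x φ).det ≠ 0 := by simpa using hφ
  refine ⟨φ, hφ, ?_⟩
  have hun : IsUnit (nodX x φ).det := isUnit_iff_ne_zero.2 hφ
  let a : Fin N → Fin d → ℝ := fun n => Matrix.vecMul (x n) (nodX x φ)⁻¹
  have hexp : ∀ n, x n = ∑ j, a n j • x (φ j) := by
    intro n
    have h1 : Matrix.vecMul (a n) (nodX x φ) = x n := by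
      simp only [a]
      rw [Matrix.vecMul_vecMul, Matrix.nonsing_inv_mul _ hun, Matrix.vecMul_one]
    rw [← h1, Matrix.vecMul_eq_sum]
    rfl
  have hexch : ∀ n i, a n i ≠ 0 → v n ≤ v (φ i) := by
    intro n i hne
    have h1 : (nodX x (Function.update φ i n)).det = a n i * (nodX x φ).det := by
      have h2 : nodX x (Function.update φ i n) =
          (nodX x φ).updateRow i (∑ j, a n j • (nodX x φ) j) := by
        ext r s
        by_cases hr : r = i
        · subst hr
          simp only [nodX, Matrix.of_apply, Function.update_self, Matrix.updateRow_self]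
          exact congrFun (hexp n) s
        · simp [nodX, hr]
      rw [h2, Matrix.det_updateRow_sum]
      simp
    have h2 := hmax (Function.update φ i n) (by simp [h1, hne, hφ])
    have h3 : ∑ j, v (Function.update φ i n j) = ∑ j, v (φ j) - v (φ i) + v n := by
      rw [← Finset.add_sum_erase _ _ (Finset.mem_univ i),
        ← Finset.add_sum_erase Finset.univ (fun j => v (φ j)) (Finset.mem_univ i)]
      rw [Finset.sum_congr rfl (g := fun j => v (φ j))]
      · simp; ring
      · intro j hj
        rw [Function.update_of_ne (Finset.ne_of_mem_erase hj)]
    linarith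
  have hcount : ∀ t : ℝ, d * (Finset.univ.filter fun n => t ≤ v n).card ≤
      N * (Finset.univ.filter fun i => t ≤ v (φ i)).card ∧
      ((∃ n, t ≤ v n) → (∃ n, v n < t) → d * (Finset.univ.filter fun n => t ≤ v n).card <
      N * (Finset.univ.filter fun i => t ≤ v (φ i)).card) := by
    intro t
    set U := Finset.univ.filter fun n => t ≤ v n with hU
    set J := Finset.univ.filter fun i => t ≤ v (φ i) with hJ
    let V : Submodule ℝ (Fin d → ℝ) := Submodule.span ℝ ((J.image fun i => x (φ i) : Finset _) : Set (Fin d → ℝ))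
    have hVJ : finrank ℝ V ≤ J.card := (finrank_span_finset_le_card _).trans Finset.card_image_le
    have hmem : ∀ n ∈ U, x n ∈ V := by
      intro n hn
      rw [hexp n]
      refine Submodule.sum_mem _ fun j _ => ?_
      by_cases h0 : a n j = 0
      · simp [h0]
      · refine V.smul_mem _ (Submodule.subset_span ?_)
        have h1 := hexch n j h0
        have h2 : t ≤ v n := by simpa [U] using hn
        simp only [Finset.coe_image, Set.mem_image]
        exact ⟨j, by simpa [J] using h2.trans h1, rfl⟩
    by_cases hUe : U.Nonempty
    · by_cases hV : V = ⊤
      · have h1 : d ≤ J.card := by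
          rw [hV] at hVJ
          simpa using hVJ
        have h2 : U.card ≤ N := by simpa using U.card_le_univ
        refine ⟨by nlinarith, fun _ ⟨n, hn⟩ => ?_⟩
        have h3 : U.card < N := by
          have : U ⊂ Finset.univ := by
            refine Finset.ssubset_univ_iff.2 fun h => ?_
            have : n ∈ U := by rw [h]; simp
            simp [U] at this
            linarith
          simpa using Finset.card_lt_card this
        nlinarith
      · have h1 := hx V hV U hUe hmem
        rw [finrank_fin_fun] at h1
        have h2 := Nat.mul_le_mul_left N hVJ
        exact ⟨by omega, fun _ _ => by omega⟩
    · rw [Finset.not_nonempty_iff_eq_empty] at hUe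
      refine ⟨by simp [hUe], fun ⟨n, hn⟩ => ?_⟩
      have : n ∈ U := by simpa [U] using hn
      simp [hUe] at this
  have : Nonempty (Fin N) := ⟨⟨0, hN⟩⟩
  obtain ⟨p, hp⟩ := Finite.exists_min v
  obtain ⟨q, hq⟩ := Finite.exists_max v
  have hpq : v p < v q := by
    obtain ⟨n, m, hnm⟩ := hv
    refine lt_of_le_of_ne (hp q) fun h => hnm ?_
    have := hp n; have := hp m; have := hq n; have := hq m
    linarith
  obtain ⟨i1, e1⟩ := nodx_layer v (v p) (v q) hp hq
  obtain ⟨i2, e2⟩ := nodx_layer (fun i => v (φ i)) (v p) (v q) (fun i => hp _) (fun i => hq _)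
  have hle : ∫ t in (v p)..(v q), ((d : ℝ) * ((Finset.univ.filter fun n => t ≤ v n).card : ℝ) + 1) ≤
      ∫ t in (v p)..(v q), ((N : ℝ) * ((Finset.univ.filter fun i => t ≤ v (φ i)).card : ℝ)) := by
    refine intervalIntegral.integral_mono_on_of_le_Ioo hpq.le
      ((i1.const_mul _).add intervalIntegrable_const) (i2.const_mul _) ?_
    intro t ht
    have := (hcount t).2 ⟨q, ht.2.le⟩ ⟨p, ht.1⟩
    exact_mod_cast this
  rw [intervalIntegral.integral_add (i1.const_mul _) intervalIntegrable_const,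
    intervalIntegral.integral_const_mul, intervalIntegral.integral_const_mul, e1, e2] at hle
  simp only [intervalIntegral.integral_const, Finset.sum_sub_distrib, Finset.sum_const,
    Finset.card_univ, Fintype.card_fin, nsmul_eq_mul, smul_eq_mul] at hle
  nlinarith

/-- The exponents. -/
def nodL {N d : ℕ} (φ : Fin d → Fin N) : (Fin N → ℝ) →L[ℝ] ℝ :=
  ∑ i, ContinuousLinearMap.proj (φ i) - ((d : ℝ) / N) • ∑ n, ContinuousLinearMap.proj n

lemma nodL_apply {N d : ℕ} (φ : Fin d → Fin N) (t : Fin N → ℝ) :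
    nodL φ t = ∑ i, t (φ i) - ((d : ℝ) / N) * ∑ n, t n := by
  simp [nodL]

/-- The coefficients. -/
def nodC {N d : ℕ} (x : Fin N → Fin d → ℝ) (φ : Fin d → Fin N) : ℝ := (nodX x φ).det ^ 2

/-- The energy. -/
def nodE {N d : ℕ} (x : Fin N → Fin d → ℝ) (t : Fin N → ℝ) : ℝ :=
  nodG (fun φ : Fin d → Fin N => nodL φ) (nodC x) t

lemma nodE_eq {N d : ℕ} (x : Fin N → Fin d → ℝ) (t : Fin N → ℝ) :
    nodE x t = Real.exp (-((d : ℝ) / N) * ∑ n, t n) *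
      (d.factorial * (nodM x (fun n => Real.exp (t n))).det) := by
  rw [nodM_det, Finset.mul_sum]
  unfold nodE nodG nodC
  refine Finset.sum_congr rfl fun φ _ => ?_
  beta_reduce
  rw [nodL_apply, ← Real.exp_sum, sub_eq_add_neg, Real.exp_add, neg_mul]
  ring

lemma nodM_posDef {N d : ℕ} (hN : 0 < N) (x : Fin N → Fin d → ℝ) (hx : NodStable x)
    (w : Fin N → ℝ) (hw : ∀ n, 0 < w n) : (nodM x w).PosDef := by
  have h1 : (nodM x w).PosSemidef := by
    unfold nodM
    refine Matrix.posSemidef_sum _ fun n _ => ?_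
    exact (Matrix.posSemidef_vecMulVec_self_star (x n)).smul (hw n).le
  rw [h1.posDef_iff_det_ne_zero]
  intro h0
  have h2 := nodM_det x w
  rw [h0, mul_zero] at h2
  obtain ⟨φ, hφ⟩ := nodx_exists_basis hN x hx
  have : 0 < ∑ φ : Fin d → Fin N, (nodX x φ).det ^ 2 * ∏ i, w (φ i) := by
    refine Finset.sum_pos' (fun φ _ => ?_) ⟨φ, Finset.mem_univ _, ?_⟩
    · exact mul_nonneg (sq_nonneg _) (Finset.prod_nonneg fun i _ => (hw _).le)
    · exact mul_pos (by positivity) (Finset.prod_pos fun i _ => hw _)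
  linarith

lemma nodE_pos {N d : ℕ} (hN : 0 < N) (x : Fin N → Fin d → ℝ) (hx : NodStable x)
    (t : Fin N → ℝ) : 0 < nodE x t := by
  rw [nodE_eq]
  have := (nodM_posDef hN x hx _ (fun n => Real.exp_pos (t n))).det_pos
  positivity

/-- Normalized leverage. -/
def nodq {N d : ℕ} (x : Fin N → Fin d → ℝ) (w : Fin N → ℝ) (n : Fin N) : ℝ :=
  w n * (x n ⬝ᵥ Matrix.mulVec (nodM x w)⁻¹ (x n))

lemma nodE_shift {N d : ℕ} (hN : 0 < N) (x : Fin N → Fin d → ℝ) (hx : NodStable x)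
    (t : Fin N → ℝ) (n : Fin N) (h : ℝ) :
    nodE x (t + h • Pi.single n 1) = nodE x t *
      ((1 + (Real.exp h - 1) * nodq x (fun n => Real.exp (t n)) n) *
        Real.exp (-((d : ℝ) / N) * h)) := by
  classical
  have hM := nodM_posDef hN x hx _ (fun n => Real.exp_pos (t n))
  have h1 : nodM x (fun k => Real.exp ((t + h • Pi.single n 1 : Fin N → ℝ) k)) =
      nodM x (fun n => Real.exp (t n)) + Matrix.replicateCol Unit
        ((Real.exp (t n) * (Real.exp h - 1)) • x n) * Matrix.replicateRow Unit (x n) := by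
    rw [← Matrix.vecMulVec_eq, Matrix.smul_vecMulVec]
    unfold nodM
    rw [← Finset.add_sum_erase _ _ (Finset.mem_univ n),
      ← Finset.add_sum_erase Finset.univ (fun k => Real.exp (t k) • Matrix.vecMulVec (x k) (x k))
        (Finset.mem_univ n)]
    rw [Finset.sum_congr rfl (s₁ := Finset.univ.erase n)
      (g := fun k => Real.exp (t k) • Matrix.vecMulVec (x k) (x k))]
    · simp only [Pi.add_apply, Pi.smul_apply, Pi.single_eq_same, smul_eq_mul, mul_one, Real.exp_add]
      module
    · intro k hk
      simp [Pi.single_eq_of_ne (Finset.ne_of_mem_erase hk)]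
  have h2 : (nodM x (fun k => Real.exp ((t + h • Pi.single n 1 : Fin N → ℝ) k))).det =
      (nodM x (fun n => Real.exp (t n))).det *
        (1 + (Real.exp h - 1) * nodq x (fun n => Real.exp (t n)) n) := by
    rw [h1, Matrix.det_add_replicateCol_mul_replicateRow (isUnit_iff_ne_zero.2 hM.det_pos.ne')]
    congr 1
    rw [Matrix.det_unique, Matrix.add_apply, Matrix.one_apply_eq]
    congr 1
    rw [Matrix.mul_assoc, ← Matrix.replicateCol_mulVec]
    simp only [Matrix.mul_apply, Matrix.replicateRow_apply, Matrix.replicateCol_apply,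
      Matrix.mulVec_smul, nodq, dotProduct, Pi.smul_apply, smul_eq_mul, Finset.mul_sum]
    refine Finset.sum_congr rfl fun i _ => ?_
    ring
  rw [nodE_eq, nodE_eq, h2]
  have h3 : ∑ k, (t + h • Pi.single n 1 : Fin N → ℝ) k = ∑ k, t k + h := by
    simp [Finset.sum_add_distrib, ← Finset.mul_sum]
  rw [h3, mul_add, Real.exp_add]
  ring

lemma nodE_hasDerivAt {N d : ℕ} (hN : 0 < N) (x : Fin N → Fin d → ℝ) (hx : NodStable x)
    (t : Fin N → ℝ) (n : Fin N) :
    HasDerivAt (fun h : ℝ => nodE x (t + h • Pi.single n 1))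
      (nodE x t * (nodq x (fun n => Real.exp (t n)) n - (d : ℝ) / N)) 0 := by
  have h1 : (fun h : ℝ => nodE x (t + h • Pi.single n 1)) = fun h => nodE x t *
      ((1 + (Real.exp h - 1) * nodq x (fun n => Real.exp (t n)) n) *
        Real.exp (-((d : ℝ) / N) * h)) := by
    ext h; exact nodE_shift hN x hx t n h
  rw [h1]
  have h2 := ((((Real.hasDerivAt_exp 0).sub_const 1).mul_const
    (nodq x (fun n => Real.exp (t n)) n)).const_add 1).mul
    (((hasDerivAt_id (0 : ℝ)).const_mul (-((d : ℝ) / N))).exp)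
  have h3 := h2.const_mul (nodE x t)
  refine h3.congr_deriv ?_
  simp only [Real.exp_zero, id, mul_zero, sub_self, zero_mul, add_zero]
  ring

lemma nodE_crit {N d : ℕ} (hN : 0 < N) (x : Fin N → Fin d → ℝ) (hx : NodStable x)
    (t : Fin N → ℝ) (hmin : ∀ t', nodE x t ≤ nodE x t') (n : Fin N) :
    nodq x (fun n => Real.exp (t n)) n = (d : ℝ) / N := by
  have h1 := nodE_hasDerivAt hN x hx t n
  have h2 : IsLocalMin (fun h : ℝ => nodE x (t + h • Pi.single n 1)) 0 :=
    Filter.Eventually.of_forall fun h => by simpa using hmin _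
  have h3 := h2.hasDerivAt_eq_zero h1
  rcases mul_eq_zero.1 h3 with h4 | h4
  · exact absurd h4 (nodE_pos hN x hx t).ne'
  · linarith

lemma nodE_min_zero {N d : ℕ} (hN : 0 < N) (x : Fin N → Fin d → ℝ) (hx : NodStable x)
    (hq : ∀ n, nodq x (fun _ => 1) n = (d : ℝ) / N) (t : Fin N → ℝ) : nodE x 0 ≤ nodE x t := by
  let L : (Fin N → ℝ) →L[ℝ] ℝ := ∑ φ : Fin d → Fin N, nodC x φ • nodL φ
  have hLa : ∀ t, L t = ∑ φ : Fin d → Fin N, nodC x φ * nodL φ t := by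
    intro t; simp [L]
  have hC : ∀ φ : Fin d → Fin N, 0 ≤ nodC x φ := fun φ => sq_nonneg _
  have hL1 : ∀ n, L (Pi.single n 1) = 0 := by
    intro n
    have h1 := nodE_hasDerivAt hN x hx 0 n
    have h2 : HasDerivAt (fun h : ℝ => nodE x (0 + h • Pi.single n 1)) (L (Pi.single n 1)) 0 := by
      have e : (fun h : ℝ => nodE x (0 + h • Pi.single n 1)) = fun h : ℝ =>
          ∑ φ : Fin d → Fin N, nodC x φ * Real.exp (h * nodL φ (Pi.single n 1)) := by
        ext h
        simp [nodE, nodG]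
      rw [e, hLa]
      refine HasDerivAt.fun_sum fun φ _ => ?_
      have := (((hasDerivAt_id (0 : ℝ)).mul_const (nodL φ (Pi.single n 1))).exp).const_mul (nodC x φ)
      refine this.congr_deriv ?_
      simp
    rw [h2.unique h1]
    have : (fun k => Real.exp ((0 : Fin N → ℝ) k)) = fun _ => (1 : ℝ) := by ext; simp
    rw [this, hq, sub_self, mul_zero]
  have hL0 : L t = 0 := by
    have h1 : t = ∑ n, t n • (Pi.single n 1 : Fin N → ℝ) := by
      ext k; simp [Finset.sum_apply, Pi.single_apply]
    rw [h1, map_sum]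
    simp [hL1]
  have h1 : nodE x 0 + L t ≤ nodE x t := by
    rw [hLa]
    unfold nodE nodG
    rw [← Finset.sum_add_distrib]
    refine Finset.sum_le_sum fun φ _ => ?_
    have := mul_le_mul_of_nonneg_left (Real.add_one_le_exp (nodL φ t)) (hC φ)
    simp only [map_zero, Real.exp_zero]
    linarith
  linarith

/-- The sum-zero hyperplane. -/
abbrev nodH (N : ℕ) : Submodule ℝ (Fin N → ℝ) :=
  LinearMap.ker (∑ n, LinearMap.proj n : (Fin N → ℝ) →ₗ[ℝ] ℝ)

lemma nodH_mem {N : ℕ} (t : Fin N → ℝ) : t ∈ nodH N ↔ ∑ n, t n = 0 := by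
  simp [nodH, LinearMap.sum_apply]

lemma nodE_path {N d : ℕ} (hN : 0 < N) (hd : 0 < d) (x : unitInterval → Fin N → Fin d → ℝ)
    (hxc : Continuous x) (hx : ∀ s, NodStable (x s)) :
    ∃ τ : unitInterval → Fin N → ℝ, Continuous τ ∧ (∀ s t, nodE (x s) (τ s) ≤ nodE (x s) t) ∧
      ∀ s, (∀ t, nodE (x s) 0 ≤ nodE (x s) t) → τ s = 0 := by
  have hN' : (N : ℝ) ≠ 0 := by positivity
  let l : (Fin d → Fin N) → nodH N →L[ℝ] ℝ := fun φ => (nodL φ).comp (nodH N).subtypeL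
  have hc0 : ∀ s φ, 0 ≤ nodC (x s) φ := fun s φ => sq_nonneg _
  have hdir : ∀ s (v : nodH N), v ≠ 0 → ∃ φ, 0 < nodC (x s) φ ∧ 0 < l φ v := by
    intro s v hv
    have hv0 := (nodH_mem v.1).1 v.2
    have hne : ∃ n m, v.1 n ≠ v.1 m := by
      by_contra hall
      push Not at hall
      apply hv
      ext n
      have h1 : ∑ m, v.1 m = N * v.1 n := by
        rw [Finset.sum_congr rfl fun m _ => hall m n]; simp
      rw [hv0] at h1
      rcases mul_eq_zero.1 h1.symm with h2 | h2
      · exact absurd h2 hN'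
      · simpa using h2
    obtain ⟨φ, h1, h2⟩ := nodx_greedy hN hd (x s) (hx s) v.1 hne
    refine ⟨φ, by unfold nodC; positivity, ?_⟩
    have : l φ v = nodL φ v.1 := rfl
    rw [this, nodL_apply, hv0, mul_zero, sub_zero]
    rw [hv0, mul_zero] at h2
    exact pos_of_mul_pos_right h2 (by positivity)
  have hcc : Continuous fun s => nodC (x s) := by
    refine continuous_pi fun φ => ?_
    unfold nodC
    refine Continuous.pow (Continuous.matrix_det ?_) 2
    unfold nodX
    refine continuous_matrix fun i j => ?_
    simp only [Matrix.of_apply]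
    fun_prop
  obtain ⟨τ, hτc, hτ⟩ := nodG_continuous_min l (fun s => nodC (x s)) hcc hc0 hdir
  have hres : ∀ s (w : nodH N), nodG (fun φ => l φ) (nodC (x s)) w = nodE (x s) w.1 :=
    fun s w => rfl
  refine ⟨fun s => (τ s).1, by fun_prop, ?_, ?_⟩
  · intro s t
    let c : ℝ := (∑ n, t n) / N
    have hmem : (fun n => t n - c) ∈ nodH N := by
      rw [nodH_mem, Finset.sum_sub_distrib]
      simp [c]
      field_simp
      ring
    have h1 := hτ s ⟨_, hmem⟩
    rw [hres, hres] at h1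
    refine h1.trans (le_of_eq ?_)
    unfold nodE nodG
    refine Finset.sum_congr rfl fun φ _ => ?_
    congr 2
    beta_reduce
    rw [nodL_apply, nodL_apply]
    simp only [Finset.sum_sub_distrib, Finset.sum_const, Finset.card_univ, Fintype.card_fin,
      nsmul_eq_mul]
    field_simp
    ring
  · intro s h0
    have := nodG_unique (fun φ => (l φ : nodH N →ₗ[ℝ] ℝ)) (nodC (x s)) (hc0 s) (hdir s) (τ s) 0
      (hτ s) (fun w => h0 w.1)
    change (τ s).1 = 0
    rw [this]; rfl

lemma funtf_parseval {N d : ℕ} (F : Matrix (Fin d) (Fin N) ℝ) (hF : F ∈ FUNTF ℝ N d)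
    (u : EuclideanSpace ℝ (Fin d)) :
    ∑ n, (inner ℝ u (col F n)) ^ 2 = ((N : ℝ) / d) * ‖u‖ ^ 2 := by
  have h1 := hF.1
  have hin : ∀ n, inner ℝ u (col F n) = ∑ i, F i n * u i := by
    intro n
    simp [PiLp.inner_apply, col]
  have hent : ∀ i j, ∑ n, F i n * F j n = ((N : ℝ) / d) * (if i = j then 1 else 0) := by
    intro i j
    have := congrFun (congrFun h1 i) j
    simpa [Matrix.mul_apply, Matrix.one_apply] using this
  simp only [hin]
  calc ∑ n, (∑ i, F i n * u i) ^ 2 = ∑ n, ∑ i, ∑ j, (F i n * F j n) * (u i * u j) := by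
        refine Finset.sum_congr rfl fun n _ => ?_
        rw [sq, Finset.sum_mul_sum]
        refine Finset.sum_congr rfl fun i _ => Finset.sum_congr rfl fun j _ => ?_
        ring
    _ = ∑ i, ∑ j, (∑ n, F i n * F j n) * (u i * u j) := by
        rw [Finset.sum_comm]
        refine Finset.sum_congr rfl fun i _ => ?_
        rw [Finset.sum_comm]
        refine Finset.sum_congr rfl fun j _ => ?_
        rw [Finset.sum_mul]
    _ = ((N : ℝ) / d) * ‖u‖ ^ 2 := by
        rw [EuclideanSpace.norm_sq_eq, Finset.mul_sum]
        refine Finset.sum_congr rfl fun i _ => ?_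
        simp only [hent, mul_ite, mul_one, mul_zero, ite_mul, zero_mul, Finset.sum_ite_eq,
          Finset.mem_univ, if_true, Real.norm_eq_abs, sq_abs]
        ring

lemma funtf_norm {N d : ℕ} (F : Matrix (Fin d) (Fin N) ℝ) (hF : F ∈ FUNTF ℝ N d) (n : Fin N) :
    ‖col F n‖ = 1 := by
  have h1 := hF.2 n
  have h2 : ‖col F n‖ ^ 2 = 1 := by
    rw [EuclideanSpace.norm_sq_eq, ← h1]
    simp [Matrix.mul_apply, col, sq]
  nlinarith [norm_nonneg (col F n)]

lemma funtf_trace {N d : ℕ} (F : Matrix (Fin d) (Fin N) ℝ) (hF : F ∈ FUNTF ℝ N d)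
    (V : Submodule ℝ (EuclideanSpace ℝ (Fin d))) :
    ∑ n, ‖V.orthogonalProjectionOnto (col F n)‖ ^ 2 = ((N : ℝ) / d) * finrank ℝ V := by
  let b := stdOrthonormalBasis ℝ V
  have h1 : ∀ n, ‖V.orthogonalProjectionOnto (col F n)‖ ^ 2 =
      ∑ j, (inner ℝ ((b j : V) : EuclideanSpace ℝ (Fin d)) (col F n)) ^ 2 := by
    intro n
    rw [← b.sum_sq_norm_inner_right (V.orthogonalProjectionOnto (col F n))]
    refine Finset.sum_congr rfl fun j _ => ?_
    rw [Submodule.inner_orthogonalProjectionOnto_eq_of_mem_left, Real.norm_eq_abs, sq_abs]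
  simp only [h1]
  rw [Finset.sum_comm]
  simp only [funtf_parseval F hF]
  have : ∀ j, ‖((b j : V) : EuclideanSpace ℝ (Fin d))‖ = 1 := fun j => b.orthonormal.1 j
  simp [this]
  ring

lemma funtf_span {N d : ℕ} (hN : 0 < N) (hd : 0 < d) (F : Matrix (Fin d) (Fin N) ℝ)
    (hF : F ∈ FUNTF ℝ N d) : Submodule.span ℝ (Set.range (col F)) = ⊤ := by
  rw [← Submodule.orthogonal_eq_bot_iff, eq_bot_iff]
  intro u hu
  have h1 := funtf_parseval F hF u
  have h2 : ∀ n, inner ℝ u (col F n) = 0 := fun n =>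
    (Submodule.mem_orthogonal' _ _).1 hu _ (Submodule.subset_span ⟨n, rfl⟩)
  simp only [h2] at h1
  have h3 : (0 : ℝ) < (N : ℝ) / d := by positivity
  have h4 : ‖u‖ ^ 2 = 0 := by
    rcases mul_eq_zero.1 (h1.symm.trans (by simp)) with h | h
    · exact absurd h h3.ne'
    · exact h
  simpa using h4

lemma stable_of_nod {N d : ℕ} (hN : 0 < N) (hd : 0 < d) (F : Matrix (Fin d) (Fin N) ℝ)
    (hF : F ∈ FUNTF ℝ N d) (h : ¬ Orthodecomposable ℝ (col F)) : NodStable (col F) := by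
  classical
  intro V hV S hS hx
  have htr := funtf_trace F hF V
  have hd' : (0 : ℝ) < d := by positivity
  rw [finrank_euclideanSpace, Fintype.card_fin]
  have hS1 : ∑ n ∈ S, ‖V.orthogonalProjectionOnto (col F n)‖ ^ 2 = S.card := by
    rw [Finset.sum_congr rfl (g := fun _ => (1 : ℝ))]
    · simp
    · intro n hn
      have : ‖V.orthogonalProjectionOnto (col F n)‖ = ‖col F n‖ := by
        rw [Submodule.coe_norm]
        congr 1
        exact Submodule.starProjection_eq_self_iff.2 (hx n hn)
      rw [this, funtf_norm F hF]; norm_num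
  have hsplit := Finset.sum_add_sum_compl S (fun n => ‖V.orthogonalProjectionOnto (col F n)‖ ^ 2)
  rw [hS1, htr] at hsplit
  by_contra hlt
  push Not at hlt
  have hlt' : (N : ℝ) / d * finrank ℝ V ≤ S.card := by
    rw [div_mul_eq_mul_div, div_le_iff₀ hd']
    have : ((N * finrank ℝ V : ℕ) : ℝ) ≤ ((d * S.card : ℕ) : ℝ) := by exact_mod_cast hlt
    push_cast at this
    linarith
  have hz : ∑ n ∈ Sᶜ, ‖V.orthogonalProjectionOnto (col F n)‖ ^ 2 = 0 :=
    le_antisymm (by linarith) (Finset.sum_nonneg fun n _ => sq_nonneg _)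
  have hperp : ∀ n, n ∉ S → col F n ∈ Vᗮ := by
    intro n hn
    have h1 := (Finset.sum_eq_zero_iff_of_nonneg (fun n _ => sq_nonneg _)).1 hz n (by simpa using hn)
    have h2 : V.orthogonalProjectionOnto (col F n) = 0 := norm_eq_zero.1 (pow_eq_zero_iff two_ne_zero |>.1 h1)
    exact Submodule.orthogonalProjectionOnto_eq_zero_iff.1 h2
  set A := Submodule.span ℝ (col F '' (S : Set (Fin N))) with hA
  set B := Submodule.span ℝ (col F '' ((S : Set (Fin N))ᶜ)) with hB
  have hAV : A ≤ V := by
    rw [hA, Submodule.span_le]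
    rintro _ ⟨n, hn, rfl⟩
    exact hx n hn
  have hBV : B ≤ Vᗮ := by
    rw [hB, Submodule.span_le]
    rintro _ ⟨n, hn, rfl⟩
    exact hperp n hn
  have hAB : A ⊔ B = ⊤ := by
    rw [hA, hB, ← Submodule.span_union, ← Set.image_union, Set.union_compl_self, Set.image_univ]
    exact funtf_span hN hd F hF
  have hABo : A ≤ Bᗮ := by
    intro a ha
    rw [Submodule.mem_orthogonal]
    intro b hb
    exact (Submodule.mem_orthogonal' _ _).1 (hBV hb) a (hAV ha)
  apply h
  refine ⟨S, (S : Set (Fin N))ᶜ, hS, ?_, disjoint_compl_right, Set.union_compl_self _, ?_⟩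
  · by_contra hT
    rw [Set.not_nonempty_iff_eq_empty] at hT
    rw [hT, Set.image_empty, Submodule.span_empty] at hB
    rw [hB, sup_bot_eq] at hAB
    rw [hAB] at hAV
    exact hV (top_le_iff.1 hAV)
  · change A = Bᗮ
    refine le_antisymm hABo ?_
    intro u hu
    have hut : u ∈ A ⊔ B := by rw [hAB]; trivial
    obtain ⟨a, ha, b, hb, rfl⟩ := Submodule.mem_sup.1 hut
    have h1 : b ∈ Bᗮ := by
      have := Bᗮ.sub_mem hu (hABo ha)
      simpa using this
    have h2 : b = 0 := by
      have := (Submodule.mem_orthogonal _ _).1 h1 b hb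
      simpa using this
    rw [h2, add_zero]; exact ha

lemma nod_of_stable {N d : ℕ} (hd : 0 < d) (F : Matrix (Fin d) (Fin N) ℝ)
    (hF : F ∈ FUNTF ℝ N d) (h : NodStable (col F)) : ¬ Orthodecomposable ℝ (col F) := by
  classical
  rintro ⟨S, T, hS, hT, hdisj, hun, hspan⟩
  set V := Submodule.span ℝ (col F '' S) with hV
  have hd' : (0 : ℝ) < d := by positivity
  have hSV : ∀ n ∈ S, col F n ∈ V := fun n hn => Submodule.subset_span ⟨n, hn, rfl⟩
  have hTV : ∀ n ∈ T, col F n ∈ Vᗮ := by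
    intro n hn
    rw [hspan]
    exact Submodule.le_orthogonal_orthogonal _ (Submodule.subset_span ⟨n, hn, rfl⟩)
  have hVt : V ≠ ⊤ := by
    intro h0
    obtain ⟨n, hn⟩ := hT
    have h1 := hTV n hn
    rw [h0, Submodule.top_orthogonal_eq_bot, Submodule.mem_bot] at h1
    have := funtf_norm F hF n
    rw [h1] at this
    simp at this
  have h1 := h V hVt S.toFinset (by simpa using hS) (fun n hn => hSV n (by simpa using hn))
  have htr := funtf_trace F hF V
  have h2 : ∀ n, ‖V.orthogonalProjectionOnto (col F n)‖ ^ 2 = if n ∈ S then 1 else 0 := by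
    intro n
    split_ifs with hn
    · have : ‖V.orthogonalProjectionOnto (col F n)‖ = ‖col F n‖ := by
        rw [Submodule.coe_norm]
        congr 1
        exact Submodule.starProjection_eq_self_iff.2 (hSV n hn)
      rw [this, funtf_norm F hF]; norm_num
    · have hnT : n ∈ T := by
        have : n ∈ S ∪ T := by rw [hun]; trivial
        exact this.resolve_left hn
      rw [Submodule.orthogonalProjectionOnto_eq_zero_iff.2 (hTV n hnT)]
      simp
  simp only [h2] at htr
  rw [Finset.sum_boole] at htr
  have h3 : (Finset.univ.filter fun n => n ∈ S) = S.toFinset := by ext; simp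
  rw [h3, div_mul_eq_mul_div, eq_div_iff hd'.ne'] at htr
  rw [finrank_euclideanSpace, Fintype.card_fin] at h1
  have h4 : S.toFinset.card * d = N * finrank ℝ V := by exact_mod_cast htr
  nlinarith

lemma nodM_entry {N d : ℕ} (x : Fin N → Fin d → ℝ) (w : Fin N → ℝ) (i j : Fin d) :
    nodM x w i j = ∑ n, w n * (x n i * x n j) := by
  simp [nodM, Matrix.sum_apply, Matrix.vecMulVec_apply]

lemma nodM_conj {N d : ℕ} (x : Fin N → Fin d → ℝ) (w : Fin N → ℝ)
    (B : Matrix (Fin d) (Fin d) ℝ) (hB : B.transpose = B) :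
    B * nodM x w * B = nodM (fun n => Matrix.mulVec B (x n)) w := by
  unfold nodM
  rw [Matrix.mul_sum, Matrix.sum_mul]
  refine Finset.sum_congr rfl fun n _ => ?_
  rw [Matrix.mul_smul, Matrix.smul_mul, Matrix.mul_vecMulVec, Matrix.vecMulVec_mul]
  congr 2
  rw [← Matrix.mulVec_transpose, hB]

/-- The normalized frame. -/
def nodY {N d : ℕ} (x : Fin N → Fin d → ℝ) (t : Fin N → ℝ) (B : Matrix (Fin d) (Fin d) ℝ) :
    Matrix (Fin d) (Fin N) ℝ :=
  Matrix.of fun i n => (Real.sqrt ((N : ℝ) / d) * Real.exp (t n / 2)) * Matrix.mulVec B (x n) i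

lemma nodY_mem {N d : ℕ} (hN : 0 < N) (hd : 0 < d) (x : Fin N → Fin d → ℝ) (hx : NodStable x)
    (t : Fin N → ℝ) (B : Matrix (Fin d) (Fin d) ℝ) (hB : B.transpose = B)
    (hBB : B * B = (nodM x (fun n => Real.exp (t n)))⁻¹)
    (hq : ∀ n, nodq x (fun n => Real.exp (t n)) n = (d : ℝ) / N) :
    nodY x t B ∈ {F ∈ FUNTF ℝ N d | ¬ Orthodecomposable ℝ (col F)} := by
  have hM := nodM_posDef hN x hx _ (fun n => Real.exp_pos (t n))
  set M := nodM x (fun n => Real.exp (t n)) with hMdef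
  have hu : IsUnit M.det := isUnit_iff_ne_zero.2 hM.det_pos.ne'
  have h1 : B * (B * M) = 1 := by rw [← Matrix.mul_assoc, hBB, Matrix.nonsing_inv_mul _ hu]
  have h2 : (B * M) * B = 1 := mul_eq_one_comm.1 h1
  have h3 : B * (M * B) = 1 := by rw [← Matrix.mul_assoc]; exact h2
  have h4 : (M * B) * B = 1 := mul_eq_one_comm.1 h3
  have hNd : (0 : ℝ) < (N : ℝ) / d := by positivity
  have hsq : Real.sqrt ((N : ℝ) / d) * Real.sqrt ((N : ℝ) / d) = (N : ℝ) / d :=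
    Real.mul_self_sqrt hNd.le
  have hex : ∀ n, Real.exp (t n / 2) * Real.exp (t n / 2) = Real.exp (t n) := by
    intro n; rw [← Real.exp_add]; congr 1; ring
  have hs2 : ∀ n, (Real.sqrt ((N : ℝ) / d) * Real.exp (t n / 2)) *
      (Real.sqrt ((N : ℝ) / d) * Real.exp (t n / 2)) = ((N : ℝ) / d) * Real.exp (t n) := by
    intro n; rw [mul_mul_mul_comm, hsq, hex n]
  have hF : nodY x t B ∈ FUNTF ℝ N d := by
    constructor
    · have h5 := nodM_conj x (fun n => Real.exp (t n)) B hB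
      rw [← hMdef, h2] at h5
      rw [h5]
      ext i j
      rw [Matrix.smul_apply, nodM_entry, Matrix.mul_apply, smul_eq_mul, Finset.mul_sum]
      refine Finset.sum_congr rfl fun n _ => ?_
      simp only [nodY, Matrix.conjTranspose_apply, Matrix.of_apply, star_trivial]
      linear_combination (Matrix.mulVec B (x n) i * Matrix.mulVec B (x n) j) * hs2 n
    · intro n
      have h5 : Matrix.mulVec B (x n) ⬝ᵥ Matrix.mulVec B (x n) =
          x n ⬝ᵥ Matrix.mulVec M⁻¹ (x n) := by
        rw [← hBB, ← Matrix.mulVec_mulVec, Matrix.dotProduct_mulVec (x n) B,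
          ← Matrix.mulVec_transpose, hB]
      have h6 := hq n
      unfold nodq at h6
      rw [← hMdef, ← h5] at h6
      have h7 : ((nodY x t B).conjTranspose * nodY x t B) n n = ((N : ℝ) / d) *
          (Real.exp (t n) * (Matrix.mulVec B (x n) ⬝ᵥ Matrix.mulVec B (x n))) := by
        rw [Matrix.mul_apply, dotProduct, Finset.mul_sum, Finset.mul_sum]
        refine Finset.sum_congr rfl fun i _ => ?_
        simp only [nodY, Matrix.conjTranspose_apply, Matrix.of_apply, star_trivial]
        linear_combination (Matrix.mulVec B (x n) i * Matrix.mulVec B (x n) i) * hs2 n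
      rw [h7, h6]
      field_simp
  refine ⟨hF, nod_of_stable hd _ hF ?_⟩
  have h8 := hx.map ((Matrix.toLin'OfInv h4 h3).trans (WithLp.linearEquiv 2 ℝ (Fin d → ℝ)).symm)
    (fun n => Real.sqrt ((N : ℝ) / d) * Real.exp (t n / 2))
    (fun n => by have := Real.sqrt_pos.2 hNd; positivity)
  convert h8 using 1
  ext n i
  simp [col, nodY]

lemma nod_endpoint {N d : ℕ} (hN : 0 < N) (hd : 0 < d) (F : Matrix (Fin d) (Fin N) ℝ)
    (hF : F ∈ FUNTF ℝ N d) :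
    nodM (fun n i => F i n) (fun _ => 1) = ((N : ℝ) / d) • 1 ∧
    ∀ n, nodq (fun n i => F i n) (fun _ => 1) n = (d : ℝ) / N := by
  have h1 : nodM (fun n i => F i n) (fun _ => 1) = ((N : ℝ) / d) • 1 := by
    rw [← hF.1]
    ext i j
    rw [nodM_entry, Matrix.mul_apply]
    simp
  refine ⟨h1, fun n => ?_⟩
  have h2 : (((N : ℝ) / d) • (1 : Matrix (Fin d) (Fin d) ℝ))⁻¹ = ((d : ℝ) / N) • 1 := by
    apply Matrix.inv_eq_right_inv
    rw [Matrix.smul_mul, Matrix.one_mul, smul_smul]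
    have : (N : ℝ) / d * (d / N) = 1 := by field_simp
    rw [this, one_smul]
  have h3 : (fun i => F i n) ⬝ᵥ (fun i => F i n) = 1 := by
    have := hF.2 n
    rw [← this, Matrix.mul_apply]
    simp [dotProduct]
  unfold nodq
  rw [h1, h2, Matrix.smul_mulVec, Matrix.one_mulVec, dotProduct_smul, h3]
  simp

/-- For `N ≥ d + 2 > 4`, any two non-orthodecomposable frames in `𝓕_{N,d}^ℝ` are joined by a
continuous path inside `𝓕_{N,d}^ℝ` all of whose points are non-orthodecomposable. -/
theorem nod_pathConnected_real (N d : ℕ) (hd : 3 ≤ d) (hN : d + 2 ≤ N) :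
    ∀ F ∈ {F ∈ FUNTF ℝ N d | ¬ Orthodecomposable ℝ (col F)},
      ∀ G ∈ {F ∈ FUNTF ℝ N d | ¬ Orthodecomposable ℝ (col F)},
        JoinedIn {F ∈ FUNTF ℝ N d | ¬ Orthodecomposable ℝ (col F)} F G := by
  intro F hF G hG
  have hN0 : 0 < N := by omega
  have hd0 : 0 < d := by omega
  have hNd : (0 : ℝ) < (N : ℝ) / d := by positivity
  have hst : ∀ F ∈ {F ∈ FUNTF ℝ N d | ¬ Orthodecomposable ℝ (col F)},
      NodStable (fun n i => F i n : Fin N → Fin d → ℝ) := by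
    intro F hF
    have h1 := (stable_of_nod hN0 hd0 F hF.1 hF.2).map (WithLp.linearEquiv 2 ℝ (Fin d → ℝ))
      (fun _ => 1) (fun _ => one_ne_zero)
    convert h1 using 1
    ext n i
    simp [col]
  obtain ⟨γ, hγ⟩ := nodx_dim hd hN _ _ (hst F hF) (hst G hG)
  replace hγ : ∀ s, NodStable (γ s) := hγ
  obtain ⟨τ, hτc, hτ, hτ0⟩ := nodE_path hN0 hd0 (fun s => γ s) γ.continuous hγ
  have hMc : Continuous fun s => nodM (γ s) (fun n => Real.exp (τ s n)) := by
    refine continuous_matrix fun i j => ?_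
    simp only [nodM_entry]
    have : Continuous fun s => γ s := γ.continuous
    fun_prop
  obtain ⟨B, hBc, hBt, hBB, hB1⟩ := nodx_sqrt_path _ hMc
    (fun s => nodM_posDef hN0 (γ s) (hγ s) _ (fun n => Real.exp_pos _))
  have hend : ∀ s, ∀ F ∈ {F ∈ FUNTF ℝ N d | ¬ Orthodecomposable ℝ (col F)},
      γ s = (fun n i => F i n : Fin N → Fin d → ℝ) → nodY (γ s) (τ s) (B s) = F := by
    intro s F hF hs
    obtain ⟨e1, e2⟩ := nod_endpoint hN0 hd0 F hF.1
    have h0 : τ s = 0 := by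
      apply hτ0
      intro t
      simp only [hs]
      exact nodE_min_zero hN0 _ (hst F hF) e2 t
    have h1 := hB1 s ((N : ℝ) / d) hNd (by
      rw [hs, h0, ← e1]
      simp)
    rw [h1, h0, hs]
    ext i n
    simp only [nodY, Matrix.of_apply, Matrix.smul_mulVec, Matrix.one_mulVec, Pi.smul_apply,
      smul_eq_mul, Pi.zero_apply, zero_div, Real.exp_zero, mul_one]
    rw [← mul_assoc, ← Real.sqrt_mul hNd.le, mul_inv_cancel₀ hNd.ne', Real.sqrt_one, one_mul]
  refine ⟨⟨⟨fun s => nodY (γ s) (τ s) (B s), ?_⟩, ?_, ?_⟩, ?_⟩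
  · refine continuous_matrix fun i n => ?_
    simp only [nodY, Matrix.of_apply, Matrix.mulVec, dotProduct]
    have h1 : Continuous fun s => γ s := γ.continuous
    have h2 : ∀ j, Continuous fun s => B s i j := fun j => hBc.matrix_elem i j
    fun_prop
  · exact hend 0 F hF γ.source
  · exact hend 1 G hG γ.target
  · intro s
    exact nodY_mem hN0 hd0 (γ s) (hγ s) (τ s) (B s) (hBt s) (hBB s)
      (nodE_crit hN0 (γ s) (hγ s) (τ s) (hτ s))
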